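/- Fix m ≥ 2 and n ≥ 2. The number T_{n,m} of tiered trees on {1,…,n} with tiering functions valued in {1,…,m} (surjective or not) is given by T_{n,m} = (1/(n·m^{n−1})) · Σ ( n choose k_1, k_2, …, k_m ) · ((m−1)·k_1 + (m−2)·k_2 + ⋯ + k_{m−1})^{n−1}, where the sum ranges over all tuples (k_1,…,k_m) of nonnegative integers with k_1 + ⋯ + k_m = n, and (n choose k_1,…,k_m) is the multinomial coefficient. -/

import Mathlib

open scoped Classical

/-- Reachability along a finite edge set (edges are unordered pairs of naturals). -/
def EReach (E : Finset (Sym2 ℕ)) : ℕ → ℕ → Prop :=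
  Relation.ReflTransGen fun a b => s(a, b) ∈ E

/-- `E` is the edge set of a tree on the vertex set `V`: all edges join distinct
vertices of `V`, any two vertices of `V` are joined by a walk, and the number of
edges is one less than the number of vertices. -/
def IsTreeOn (V : Finset ℕ) (E : Finset (Sym2 ℕ)) : Prop :=
  (∀ e ∈ E, ∀ x ∈ e, x ∈ V) ∧ (∀ e ∈ E, ¬ e.IsDiag) ∧
    (∀ a ∈ V, ∀ b ∈ V, EReach E a b) ∧ E.card + 1 = V.card

/-- `t` is a tiering function (with tiers `1, …, m`) for the graph with vertex set `V`
and edge set `E`: tiers lie in `{1, …, m}` and if `a < b` are adjacent then `t a < t b`. -/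
def IsTieredOn (V : Finset ℕ) (E : Finset (Sym2 ℕ)) (m : ℕ) (t : ℕ → ℕ) : Prop :=
  (∀ v ∈ V, t v ∈ Finset.Icc 1 m) ∧ ∀ a b : ℕ, s(a, b) ∈ E → a < b → t a < t b

/-- Auxiliary fuelled recursion computing the weight of a tiered tree: delete the
minimal vertex `v`, and sum, over the components `C` of the resulting forest
(one for each neighbour `u` of `v`), the weight of the component plus the number
of vertices `x ∈ C` with `t x > t v` and `x < u`.  (Fuel `V.card` always suffices,
since components are strictly smaller.) -/
noncomputable def treeWeightAux (t : ℕ → ℕ) : ℕ → Finset ℕ → Finset (Sym2 ℕ) → ℕ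
  | 0, _, _ => 0
  | fuel + 1, V, E =>
    if h : 2 ≤ V.card then
      let v := V.min' (Finset.card_pos.mp (by omega))
      let E' := E.filter fun e => v ∉ e
      ((V.erase v).filter fun u => s(v, u) ∈ E).sum fun u =>
        let C := (V.erase v).filter fun x => EReach E' u x
        (C.filter fun x => t v < t x ∧ x < u).card +
          treeWeightAux t fuel C (E'.filter fun e => ∀ x ∈ e, x ∈ C)
    else 0

/-- The weight of a tiered tree with vertex set `V`, edge set `E` and tiering function `t`. -/
noncomputable def treeWeight (V : Finset ℕ) (E : Finset (Sym2 ℕ)) (t : ℕ → ℕ) : ℕ :=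
  treeWeightAux t V.card V E

/-- The set of tiered trees on `{1,…,n}` with tiering functions valued in `{1,…,m}`
(surjective or not), encoded as pairs `(E, t)` of an edge set and a tiering function,
normalised to vanish off `{1,…,n}`. -/
def TieredTrees (n m : ℕ) : Set (Finset (Sym2 ℕ) × (ℕ → ℕ)) :=
  {T | IsTreeOn (Finset.Icc 1 n) T.1 ∧ IsTieredOn (Finset.Icc 1 n) T.1 m T.2 ∧
    ∀ x, x ∉ Finset.Icc 1 n → T.2 x = 0}

/-- `T_{n,m}`: the number of tiered trees on `{1,…,n}` with tiers valued in `{1,…,m}`. -/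
noncomputable def Tcount (n m : ℕ) : ℕ := Nat.card (TieredTrees n m)

/-! ### Averaged shift operators and Abel polynomials -/

section AbelPolynomials

open Polynomial

/-- The average of the shifts `p(X), p(X + 1), …, p(X + m - 1)`. -/
noncomputable def shiftAvg (m : ℕ) : Module.End ℚ ℚ[X] :=
  (m : ℚ)⁻¹ • ∑ c ∈ Finset.range m, taylor (c : ℚ)

/-- The average of the `c • p(X + c)` for `c < m`. -/
noncomputable def weightedShiftAvg (m : ℕ) : Module.End ℚ ℚ[X] :=
  (m : ℚ)⁻¹ • ∑ c ∈ Finset.range m, (c : ℚ) • taylor (c : ℚ)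

/-- The Sheffer-type companions of the Abel polynomials `abelPoly`. -/
noncomputable def shefferPoly (m n : ℕ) : ℚ[X] := (shiftAvg m ^ n) (X ^ n)

/-- The average of the Abel polynomials `X (X + c₁ + ⋯ + cₙ) ^ (n - 1)` over all
`c₁, …, cₙ < m`. -/
noncomputable def abelPoly (m : ℕ) : ℕ → ℚ[X]
  | 0 => 1
  | n + 1 => X * (shiftAvg m ^ (n + 1)) (X ^ n)

/-- The linear coefficient of `abelPoly m n`. -/
noncomputable def abelCoeff (m n : ℕ) : ℚ := ((shiftAvg m ^ n) (X ^ (n - 1))).eval 0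

lemma shiftAvg_apply (m : ℕ) (p : ℚ[X]) :
    shiftAvg m p = (m : ℚ)⁻¹ • ∑ c ∈ Finset.range m, taylor (c : ℚ) p := by
  simp [shiftAvg]

lemma weightedShiftAvg_apply (m : ℕ) (p : ℚ[X]) :
    weightedShiftAvg m p
      = (m : ℚ)⁻¹ • ∑ c ∈ Finset.range m, (c : ℚ) • taylor (c : ℚ) p := by
  simp [weightedShiftAvg]

lemma taylor_shiftAvg (m : ℕ) (x : ℚ) (p : ℚ[X]) :
    taylor x (shiftAvg m p) = shiftAvg m (taylor x p) := by
  simp only [shiftAvg_apply, map_smul, map_sum, taylor_taylor, add_comm]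

lemma derivative_taylor_comm (x : ℚ) (p : ℚ[X]) :
    derivative (taylor x p) = taylor x (derivative p) := by
  simp [taylor_apply, derivative_comp]

lemma derivative_shiftAvg (m : ℕ) (p : ℚ[X]) :
    derivative (shiftAvg m p) = shiftAvg m (derivative p) := by
  simp only [shiftAvg_apply, map_smul, map_sum, derivative_taylor_comm]

lemma derivative_shiftAvg_pow (m n : ℕ) (p : ℚ[X]) :
    derivative ((shiftAvg m ^ n) p) = (shiftAvg m ^ n) (derivative p) := by
  induction n with
  | zero => simp
  | succ n ih => simp only [pow_succ', Module.End.mul_apply, derivative_shiftAvg, ih]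

lemma shiftAvg_X_mul (m : ℕ) (p : ℚ[X]) :
    shiftAvg m (X * p) = X * shiftAvg m p + weightedShiftAvg m p := by
  simp only [shiftAvg_apply, weightedShiftAvg_apply, taylor_mul, taylor_X, add_mul,
    Finset.sum_add_distrib, smul_add, ← Finset.mul_sum, smul_eq_C_mul]
  ring

lemma shiftAvg_weightedShiftAvg (m : ℕ) (p : ℚ[X]) :
    shiftAvg m (weightedShiftAvg m p) = weightedShiftAvg m (shiftAvg m p) := by
  rw [weightedShiftAvg_apply, weightedShiftAvg_apply, map_smul, map_sum]
  simp only [map_smul, taylor_shiftAvg]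

lemma shiftAvg_pow_succ_X_mul (m n : ℕ) (p : ℚ[X]) :
    (shiftAvg m ^ (n + 1)) (X * p)
      = X * (shiftAvg m ^ (n + 1)) p
        + (n + 1 : ℚ) • weightedShiftAvg m ((shiftAvg m ^ n) p) := by
  induction n with
  | zero => simp [shiftAvg_X_mul]
  | succ n ih =>
    rw [pow_succ', Module.End.mul_apply, ih, map_add, map_smul, shiftAvg_X_mul,
      shiftAvg_weightedShiftAvg, ← Module.End.mul_apply (shiftAvg m), ← pow_succ',
      ← Module.End.mul_apply (shiftAvg m), ← pow_succ', add_assoc]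
    congr 1
    push_cast
    module

lemma derivative_abelPoly_succ (m n : ℕ) :
    derivative (abelPoly m (n + 1)) = (n + 1 : ℚ) • shiftAvg m (abelPoly m n) := by
  cases n with
  | zero => simp [abelPoly, derivative_mul, derivative_shiftAvg]
  | succ n =>
    have h := shiftAvg_pow_succ_X_mul m (n + 1) (X ^ n)
    have hd : derivative ((X : ℚ[X]) ^ (n + 1)) = (n + 1 : ℚ) • X ^ n := by
      simp [smul_eq_C_mul]
    simp only [abelPoly, derivative_mul, derivative_X, one_mul, derivative_shiftAvg_pow, hd,
      map_smul, shiftAvg_X_mul]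
    rw [← pow_succ'] at h
    rw [h, ← Module.End.mul_apply (shiftAvg m), ← pow_succ', mul_smul_comm]
    push_cast
    module

lemma shefferPoly_succ_derivative (m n : ℕ) :
    derivative (shefferPoly m (n + 1)) = (n + 1 : ℚ) • shiftAvg m (shefferPoly m n) := by
  have hd : derivative ((X : ℚ[X]) ^ (n + 1)) = (n + 1 : ℚ) • X ^ n := by
    simp [smul_eq_C_mul]
  rw [shefferPoly, derivative_shiftAvg_pow, hd, map_smul, pow_succ', Module.End.mul_apply,
    shefferPoly]

lemma eq_of_derivative_eq_of_eval_zero_eq {p q : ℚ[X]} (hd : derivative p = derivative q)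
    (h0 : p.eval 0 = q.eval 0) : p = q := by
  have h : derivative (p - q) = 0 := by rw [derivative_sub, hd, sub_self]
  have h1 := derivative_eq_zero.mp h
  rw [natDegree_eq_zero] at h1
  obtain ⟨x, hx⟩ := h1
  have h2 : (p - q).eval 0 = 0 := by rw [eval_sub, h0, sub_self]
  rw [← hx, eval_C] at h2
  rw [h2, C_0] at hx
  exact sub_eq_zero.mp hx.symm

lemma eval_zero_abelPoly (m n : ℕ) : (abelPoly m (n + 1)).eval 0 = 0 := by
  simp [abelPoly]

/-- The averaged Abel identity. -/
lemma sum_choose_shefferPoly_abelPoly (m n : ℕ) (x : ℚ) :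
    ∑ k ∈ Finset.range (n + 1),
      (n.choose k * (shefferPoly m k).eval x : ℚ) • abelPoly m (n - k)
      = taylor x (shefferPoly m n) := by
  induction n with
  | zero => simp [shefferPoly, abelPoly]
  | succ n ih =>
    apply eq_of_derivative_eq_of_eval_zero_eq
    · rw [derivative_taylor_comm, shefferPoly_succ_derivative, map_smul, taylor_shiftAvg, ← ih,
        Finset.sum_range_succ, derivative_add, derivative_sum, map_sum, Finset.smul_sum]
      rw [Nat.sub_self, show abelPoly m 0 = 1 from rfl, derivative_smul, derivative_one,
        smul_zero, add_zero]
      simp only [map_smul]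
      refine Finset.sum_congr rfl fun k hk => ?_
      have hk' : k ≤ n := Nat.lt_succ_iff.mp (Finset.mem_range.mp hk)
      rw [Nat.succ_sub hk', derivative_abelPoly_succ, smul_smul, smul_smul]
      congr 1
      have h := Nat.choose_mul_succ_eq n k
      have h' : (n.choose k * (n + 1) : ℚ) = (n + 1).choose k * ((n - k : ℕ) + 1) := by
        rw [Nat.succ_sub hk'] at h
        exact_mod_cast h
      linear_combination (-(shefferPoly m k).eval x) * h'
    · rw [Finset.sum_range_succ, eval_add, eval_finsetSum, taylor_eval, zero_add,
        Finset.sum_eq_zero]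
      · simp [abelPoly]
      · intro k hk
        rw [Nat.succ_sub (Nat.lt_succ_iff.mp (Finset.mem_range.mp hk)), eval_smul,
          eval_zero_abelPoly, smul_zero]

lemma eval_shiftAvg (m : ℕ) (y : ℚ) (p : ℚ[X]) :
    (shiftAvg m p).eval y = (m : ℚ)⁻¹ * ∑ c ∈ Finset.range m, p.eval (y + c) := by
  simp [shiftAvg_apply, eval_finsetSum, taylor_eval]

lemma abelCoeff_succ (m n : ℕ) :
    abelCoeff m (n + 1) = (m : ℚ)⁻¹ * ∑ c ∈ Finset.range m, (shefferPoly m n).eval (c : ℚ) := by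
  rw [abelCoeff, pow_succ', Module.End.mul_apply, eval_shiftAvg]
  simp [shefferPoly]

lemma eval_abelPoly_succ (m n : ℕ) (y : ℚ) :
    (abelPoly m (n + 1)).eval y
      = ∑ k ∈ Finset.range (n + 1),
          (n.choose k : ℚ) * (y * abelCoeff m (k + 1) * (abelPoly m (n - k)).eval y) := by
  have h1 : (abelPoly m (n + 1)).eval y
      = y * ((m : ℚ)⁻¹ * ∑ c ∈ Finset.range m, (shefferPoly m n).eval (y + c)) := by
    rw [abelPoly, eval_mul, eval_X, pow_succ', Module.End.mul_apply, eval_shiftAvg, shefferPoly]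
  have h2 : ∀ c ∈ Finset.range m, (shefferPoly m n).eval (y + c)
      = ∑ k ∈ Finset.range (n + 1),
        (n.choose k * (shefferPoly m k).eval (c : ℚ)) * (abelPoly m (n - k)).eval y := by
    intro c _
    rw [← taylor_eval, ← sum_choose_shefferPoly_abelPoly, eval_finsetSum]
    simp
  rw [h1, Finset.sum_congr rfl h2, Finset.sum_comm, Finset.mul_sum, Finset.mul_sum]
  refine Finset.sum_congr rfl fun k _ => ?_
  rw [abelCoeff_succ, ← Finset.sum_mul, ← Finset.mul_sum]
  ring

lemma sum_eval_abelPoly (m n : ℕ) (hm : m ≠ 0) :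
    (n + 1 : ℚ) * ∑ c ∈ Finset.range m, (abelPoly m n).eval (c : ℚ)
      = m * abelCoeff m (n + 1) := by
  have h := congrArg (eval 0) (derivative_abelPoly_succ m n)
  rw [eval_smul, eval_shiftAvg, abelPoly, derivative_mul, derivative_X, eval_add, eval_mul,
    eval_mul, eval_X, zero_mul, add_zero, eval_one, one_mul, smul_eq_mul] at h
  simp only [zero_add] at h
  rw [abelCoeff, Nat.add_sub_cancel, h]
  have : (m : ℚ) ≠ 0 := Nat.cast_ne_zero.mpr hm
  field_simp

lemma taylor_one_pow (k : ℕ) : (taylor (1 : ℚ) : Module.End ℚ ℚ[X]) ^ k = taylor (k : ℚ) := by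
  induction k with
  | zero => ext; simp
  | succ k ih =>
    rw [pow_succ, ih]
    refine LinearMap.ext fun p => ?_
    rw [Module.End.mul_apply, taylor_taylor, Nat.cast_succ]

lemma abelCoeff_eq_sum_multinomial (m n : ℕ) (hm : m ≠ 0) :
    (m : ℚ) ^ n * abelCoeff m n
      = ∑ f ∈ Finset.Nat.antidiagonalTuple m n,
          (Nat.multinomial Finset.univ f : ℚ) *
            ((∑ j : Fin m, (m - 1 - (j : ℕ)) * f j : ℕ) : ℚ) ^ (n - 1) := by
  have hm' : (m : ℚ) ≠ 0 := Nat.cast_ne_zero.mpr hm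
  have hop : (m : ℚ) • shiftAvg m
      = aeval (taylor (1 : ℚ) : Module.End ℚ ℚ[X])
          (∑ j : Fin m, (X : ℚ[X]) ^ (m - 1 - (j : ℕ))) := by
    rw [shiftAvg, smul_smul, mul_inv_cancel₀ hm', one_smul, map_sum]
    simp only [map_pow, aeval_X, taylor_one_pow]
    rw [Fin.sum_univ_eq_sum_range (fun j => (taylor ((m - 1 - j : ℕ) : ℚ) : Module.End ℚ ℚ[X])),
      Finset.sum_range_reflect (fun j => (taylor (j : ℚ) : Module.End ℚ ℚ[X]))]
  have h : (m : ℚ) ^ n * abelCoeff m n = ((((m : ℚ) • shiftAvg m) ^ n) (X ^ (n - 1))).eval 0 := by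
    rw [_root_.smul_pow, LinearMap.smul_apply, eval_smul, abelCoeff, smul_eq_mul]
  rw [h, hop, ← map_pow, Finset.sum_pow_eq_sum_piAntidiag,
    Finset.piAntidiag_univ_fin_eq_antidiagonalTuple, map_sum, LinearMap.sum_apply, eval_finsetSum]
  refine Finset.sum_congr rfl fun f _ => ?_
  have hprod : ∏ j : Fin m, ((X : ℚ[X]) ^ (m - 1 - (j : ℕ))) ^ f j
      = X ^ (∑ j : Fin m, (m - 1 - (j : ℕ)) * f j) := by
    simp only [← pow_mul, Finset.prod_pow_eq_pow_sum]
  rw [hprod, ← nsmul_eq_mul, map_nsmul, aeval_X_pow, taylor_one_pow, LinearMap.smul_apply,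
    taylor_X_pow, eval_smul, eval_pow, eval_add, eval_X, zero_add, eval_C, nsmul_eq_mul]

end AbelPolynomials

/-! ### Walks and trees on finite sets of labels -/

lemma EReach.symm {E : Finset (Sym2 ℕ)} {a b : ℕ} (h : EReach E a b) : EReach E b a := by
  induction h with
  | refl => exact Relation.ReflTransGen.refl
  | tail _ hbc ih => exact Relation.ReflTransGen.head (Sym2.eq_swap ▸ hbc) ih

lemma EReach.of_mem {E : Finset (Sym2 ℕ)} {a b : ℕ} (h : s(a, b) ∈ E) : EReach E a b :=
  Relation.ReflTransGen.single h

lemma EReach.mono {E E' : Finset (Sym2 ℕ)} (hE : E ⊆ E') {a b : ℕ} (h : EReach E a b) :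
    EReach E' a b :=
  Relation.ReflTransGen.mono (fun _ _ h => hE h) _ _ h

/-- If every edge meeting the set `S` stays in `S`, then so does every walk from `S`. -/
lemma EReach.mem_of_closed {E : Finset (Sym2 ℕ)} {S : Finset ℕ}
    (hS : ∀ x y, s(x, y) ∈ E → x ∈ S → y ∈ S) {a b : ℕ} (h : EReach E a b) (ha : a ∈ S) :
    b ∈ S := by
  induction h with
  | refl => exact ha
  | tail _ hbc ih => exact hS _ _ hbc ih

lemma card_le_card_add_one_of_reach {V : Finset ℕ} {E : Finset (Sym2 ℕ)}
    (hV : V.Nonempty) (hE : ∀ e ∈ E, ∀ x ∈ e, x ∈ V)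
    (h : ∀ a ∈ V, ∀ b ∈ V, EReach E a b) : V.card ≤ E.card + 1 := by
  let G : SimpleGraph V := SimpleGraph.fromEdgeSet {e | e.map Subtype.val ∈ E}
  have hreach : ∀ (a : V) (b : ℕ), EReach E a b → ∀ hb : b ∈ V, G.Reachable a ⟨b, hb⟩ := by
    intro a b hab
    induction hab with
    | refl => intro _; exact SimpleGraph.Reachable.refl _
    | @tail c d _ hcd ih =>
      intro hd
      have hc : c ∈ V := hE _ hcd c (Sym2.mem_mk_left _ _)
      refine (ih hc).trans ?_
      by_cases hne : c = d
      · subst hne; exact SimpleGraph.Reachable.refl _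
      · refine SimpleGraph.Adj.reachable ?_
        rw [SimpleGraph.fromEdgeSet_adj]
        exact ⟨by simpa using hcd, fun h => hne (congrArg Subtype.val h)⟩
  have hconn : G.Connected := by
    have : Nonempty V := hV.to_subtype
    exact ⟨fun a b => hreach a b (h a a.2 b b.2) b.2⟩
  have h1 := hconn.card_vert_le_card_edgeSet_add_one
  have h2 : Nat.card G.edgeSet ≤ Nat.card (E : Set (Sym2 ℕ)) := by
    refine Nat.card_le_card_of_injective
      (fun e => ⟨e.1.map Subtype.val, ?_⟩) ?_
    · have he : e.1 ∈ {e : Sym2 V | e.map Subtype.val ∈ E} \ {e | e.IsDiag} :=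
        SimpleGraph.edgeSet_fromEdgeSet _ ▸ e.2
      exact he.1
    · intro e f hef
      exact Subtype.ext (Sym2.map.injective Subtype.val_injective (congrArg Subtype.val hef))
  simp only [Nat.card_eq_fintype_card, Fintype.card_coe, Finset.coe_sort_coe] at h1 h2
  omega

/-- The edges of `E` with both ends in `S`. -/
noncomputable def edgesWithin (E : Finset (Sym2 ℕ)) (S : Finset ℕ) : Finset (Sym2 ℕ) :=
  E.filter fun e => ∀ x ∈ e, x ∈ S

lemma mk_mem_edgesWithin {E : Finset (Sym2 ℕ)} {S : Finset ℕ} {a b : ℕ} :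
    s(a, b) ∈ edgesWithin E S ↔ s(a, b) ∈ E ∧ a ∈ S ∧ b ∈ S := by
  simp [edgesWithin]

/-- Joining two disjoint trees by an edge yields a tree. -/
lemma IsTreeOn.glue {A B : Finset ℕ} {E F : Finset (Sym2 ℕ)} (hA : IsTreeOn A E)
    (hB : IsTreeOn B F) (hAB : Disjoint A B) {a b : ℕ} (ha : a ∈ A) (hb : b ∈ B) :
    IsTreeOn (A ∪ B) (insert s(a, b) (E ∪ F)) := by
  obtain ⟨hA1, hA2, hA3, hA4⟩ := hA
  obtain ⟨hB1, hB2, hB3, hB4⟩ := hB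
  have hE : E ⊆ insert s(a, b) (E ∪ F) :=
    Finset.subset_union_left.trans (Finset.subset_insert _ _)
  have hF : F ⊆ insert s(a, b) (E ∪ F) :=
    Finset.subset_union_right.trans (Finset.subset_insert _ _)
  have hnot := Finset.disjoint_left.mp hAB
  refine ⟨?_, ?_, ?_, ?_⟩
  · intro e he x hx
    simp only [Finset.mem_insert, Finset.mem_union] at he ⊢
    rcases he with rfl | he | he
    · rcases Sym2.mem_iff.mp hx with rfl | rfl
      · exact Or.inl ha
      · exact Or.inr hb
    · exact Or.inl (hA1 e he x hx)
    · exact Or.inr (hB1 e he x hx)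
  · intro e he
    simp only [Finset.mem_insert, Finset.mem_union] at he
    rcases he with rfl | he | he
    · rw [Sym2.mk_isDiag_iff]
      rintro rfl
      exact hnot ha hb
    · exact hA2 e he
    · exact hB2 e he
  · have key : ∀ x ∈ A ∪ B, EReach (insert s(a, b) (E ∪ F)) a x := by
      intro x hx
      rcases Finset.mem_union.mp hx with hx | hx
      · exact (hA3 a ha x hx).mono hE
      · exact (EReach.of_mem (Finset.mem_insert_self _ _)).trans ((hB3 b hb x hx).mono hF)
    exact fun x hx y hy => (key x hx).symm.trans (key y hy)
  · have hd : Disjoint E F := by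
      rw [Finset.disjoint_left]
      intro e he hf
      induction e with
      | _ x y => exact hnot (hA1 _ he x (Sym2.mem_mk_left _ _)) (hB1 _ hf x (Sym2.mem_mk_left _ _))
    have hn : s(a, b) ∉ E ∪ F := by
      rw [Finset.mem_union]
      rintro (h | h)
      · exact hnot (hA1 _ h b (Sym2.mem_mk_right _ _)) hb
      · exact hnot ha (hB1 _ h a (Sym2.mem_mk_left _ _))
    rw [Finset.card_insert_of_notMem hn, Finset.card_union_of_disjoint hd,
      Finset.card_union_of_disjoint hAB]
    omega

/-- A tree whose vertex set is split into two connected parts consists of a tree on each part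
and one edge between them. -/
lemma IsTreeOn.split {A B : Finset ℕ} {E : Finset (Sym2 ℕ)} (hT : IsTreeOn (A ∪ B) E)
    (hAB : Disjoint A B) (hA : A.Nonempty) (hB : B.Nonempty)
    (hcA : ∀ a ∈ A, ∀ b ∈ A, EReach (edgesWithin E A) a b)
    (hcB : ∀ a ∈ B, ∀ b ∈ B, EReach (edgesWithin E B) a b) :
    IsTreeOn A (edgesWithin E A) ∧ IsTreeOn B (edgesWithin E B) ∧
      ∃ a ∈ A, ∃ b ∈ B, E = insert s(a, b) (edgesWithin E A ∪ edgesWithin E B) := by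
  obtain ⟨h1, h2, h3, h4⟩ := hT
  have hnot := Finset.disjoint_left.mp hAB
  have hiA : ∀ e ∈ edgesWithin E A, ∀ x ∈ e, x ∈ A := fun e he => (Finset.mem_filter.mp he).2
  have hiB : ∀ e ∈ edgesWithin E B, ∀ x ∈ e, x ∈ B := fun e he => (Finset.mem_filter.mp he).2
  have hcardA := card_le_card_add_one_of_reach hA hiA hcA
  have hcardB := card_le_card_add_one_of_reach hB hiB hcB
  have hd : Disjoint (edgesWithin E A) (edgesWithin E B) := by
    rw [Finset.disjoint_left]
    intro e he hf
    induction e with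
    | _ x y => exact hnot (hiA _ he x (Sym2.mem_mk_left _ _)) (hiB _ hf x (Sym2.mem_mk_left _ _))
  have hcross : ∃ a ∈ A, ∃ b ∈ B, s(a, b) ∈ E := by
    by_contra! hno
    obtain ⟨a, ha⟩ := hA
    obtain ⟨b, hb⟩ := hB
    refine hnot (EReach.mem_of_closed (S := A) ?_
      (h3 a (Finset.mem_union_left _ ha) b (Finset.mem_union_right _ hb)) ha) hb
    intro x y hxy hx
    rcases Finset.mem_union.mp (h1 _ hxy y (Sym2.mem_mk_right _ _)) with hy | hy
    · exact hy
    · exact absurd hxy (hno x hx y hy)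
  obtain ⟨a, ha, b, hb, hab⟩ := hcross
  have hn : s(a, b) ∉ edgesWithin E A ∪ edgesWithin E B := by
    rw [Finset.mem_union]
    rintro (h | h)
    · exact hnot (hiA _ h b (Sym2.mem_mk_right _ _)) hb
    · exact hnot ha (hiB _ h a (Sym2.mem_mk_left _ _))
  have hsub : insert s(a, b) (edgesWithin E A ∪ edgesWithin E B) ⊆ E := by
    refine Finset.insert_subset hab (Finset.union_subset ?_ ?_) <;> exact Finset.filter_subset _ _
  have hle := Finset.card_le_card hsub
  rw [Finset.card_insert_of_notMem hn, Finset.card_union_of_disjoint hd] at hle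
  rw [Finset.card_union_of_disjoint hAB] at h4
  refine ⟨⟨hiA, fun e he => h2 e (Finset.mem_filter.mp he).1, hcA, by omega⟩,
    ⟨hiB, fun e he => h2 e (Finset.mem_filter.mp he).1, hcB, by omega⟩, a, ha, b, hb, ?_⟩
  refine (Finset.eq_of_subset_of_card_le hsub ?_).symm
  rw [Finset.card_insert_of_notMem hn, Finset.card_union_of_disjoint hd]
  omega

/-! ### Families of tiered trees -/

/-- Pairs of an edge set on `W` and a function that takes values in `{1, …, m}` on `V` and
vanishes off `V`. -/
def labeledGraphSet (W V : Finset ℕ) (m : ℕ) : Set (Finset (Sym2 ℕ) × (ℕ → ℕ)) :=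
  {p | (∀ e ∈ p.1, ∀ x ∈ e, x ∈ W) ∧ (∀ v ∈ V, p.2 v ∈ Finset.Icc 1 m) ∧ ∀ v, v ∉ V → p.2 v = 0}

lemma labeledGraphSet_finite (W V : Finset ℕ) (m : ℕ) : (labeledGraphSet W V m).Finite := by
  have h1 : ((W.sym2.powerset : Finset (Finset (Sym2 ℕ))) : Set (Finset (Sym2 ℕ))).Finite :=
    Finset.finite_toSet _
  have h2 : ((fun f : ℕ →₀ ℕ => (f : ℕ → ℕ)) ''
      (V.finsupp fun _ => Finset.range (m + 1) : Finset (ℕ →₀ ℕ))).Finite :=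
    (Finset.finite_toSet _).image _
  refine (h1.prod h2).subset ?_
  rintro ⟨E, t⟩ ⟨hE, ht, ht0⟩
  refine ⟨?_, Finsupp.onFinset V t fun v hv => by_contra fun h => hv (ht0 v h), ?_, rfl⟩
  · simp only [Finset.coe_powerset, Set.mem_preimage, Set.mem_powerset_iff]
    intro e he
    exact Finset.mem_coe.mpr (Finset.mem_sym2_iff.mpr (hE e he))
  · rw [Finset.mem_coe, Finset.mem_finsupp_iff]
    refine ⟨Finsupp.support_onFinset_subset, fun v hv => ?_⟩
    have := ht v hv
    simp only [Finset.mem_Icc] at this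
    simp only [Finsupp.onFinset_apply, Finset.mem_range]
    omega

/-- The tiered trees on `V` with tiers in `{1, …, m}`. -/
noncomputable def tieredTrees (V : Finset ℕ) (m : ℕ) : Finset (Finset (Sym2 ℕ) × (ℕ → ℕ)) :=
  (labeledGraphSet_finite V V m).toFinset.filter fun p =>
    IsTreeOn V p.1 ∧ ∀ a b, s(a, b) ∈ p.1 → a < b → p.2 a < p.2 b

/-- Trees on `V` and an additional vertex `g` that are tiered on `V` and in which the neighbours of
`g` have tiers in `Y`. -/
noncomputable def ghostTrees (g : ℕ) (V : Finset ℕ) (m : ℕ) (Y : Finset ℕ) :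
    Finset (Finset (Sym2 ℕ) × (ℕ → ℕ)) :=
  (labeledGraphSet_finite (insert g V) V m).toFinset.filter fun p =>
    IsTreeOn (insert g V) p.1 ∧
      (∀ a b, s(a, b) ∈ p.1 → a ≠ g → b ≠ g → a < b → p.2 a < p.2 b) ∧
      ∀ u, s(g, u) ∈ p.1 → p.2 u ∈ Y

/-- The tiered trees on `V` with a marked vertex whose tier is in `Y`. -/
noncomputable def rootedTieredTrees (V : Finset ℕ) (m : ℕ) (Y : Finset ℕ) :
    Finset ((Finset (Sym2 ℕ) × (ℕ → ℕ)) × ℕ) :=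
  (tieredTrees V m ×ˢ V).filter fun q => q.1.2 q.2 ∈ Y

lemma mem_tieredTrees {V : Finset ℕ} {m : ℕ} {p : Finset (Sym2 ℕ) × (ℕ → ℕ)} :
    p ∈ tieredTrees V m ↔ (∀ v ∈ V, p.2 v ∈ Finset.Icc 1 m) ∧ (∀ v, v ∉ V → p.2 v = 0) ∧
      IsTreeOn V p.1 ∧ ∀ a b, s(a, b) ∈ p.1 → a < b → p.2 a < p.2 b := by
  simp only [tieredTrees, labeledGraphSet, Finset.mem_filter, Set.Finite.mem_toFinset,
    Set.mem_ofPred_eq]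
  exact ⟨fun h => ⟨h.1.2.1, h.1.2.2, h.2⟩, fun h => ⟨⟨h.2.2.1.1, h.1, h.2.1⟩, h.2.2⟩⟩

lemma mem_ghostTrees {g : ℕ} {V : Finset ℕ} {m : ℕ} {Y : Finset ℕ}
    {p : Finset (Sym2 ℕ) × (ℕ → ℕ)} :
    p ∈ ghostTrees g V m Y ↔ (∀ v ∈ V, p.2 v ∈ Finset.Icc 1 m) ∧ (∀ v, v ∉ V → p.2 v = 0) ∧
      IsTreeOn (insert g V) p.1 ∧
      (∀ a b, s(a, b) ∈ p.1 → a ≠ g → b ≠ g → a < b → p.2 a < p.2 b) ∧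
      ∀ u, s(g, u) ∈ p.1 → p.2 u ∈ Y := by
  simp only [ghostTrees, labeledGraphSet, Finset.mem_filter, Set.Finite.mem_toFinset,
    Set.mem_ofPred_eq]
  exact ⟨fun h => ⟨h.1.2.1, h.1.2.2, h.2⟩, fun h => ⟨⟨h.2.2.1.1, h.1, h.2.1⟩, h.2.2⟩⟩

lemma mem_rootedTieredTrees {V : Finset ℕ} {m : ℕ} {Y : Finset ℕ}
    {q : (Finset (Sym2 ℕ) × (ℕ → ℕ)) × ℕ} :
    q ∈ rootedTieredTrees V m Y ↔ q.1 ∈ tieredTrees V m ∧ q.2 ∈ V ∧ q.1.2 q.2 ∈ Y := by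
  simp [rootedTieredTrees, and_assoc]

lemma Tcount_eq_card_tieredTrees (n m : ℕ) :
    Tcount n m = (tieredTrees (Finset.Icc 1 n) m).card := by
  have h : TieredTrees n m = (tieredTrees (Finset.Icc 1 n) m : Set _) := by
    ext p
    rw [Finset.mem_coe, mem_tieredTrees]
    exact ⟨fun h => ⟨h.2.1.1, h.2.2, h.1, h.2.1.2⟩, fun h => ⟨h.2.2.1, ⟨h.1, h.2.2.2⟩, h.2.1⟩⟩
  rw [Tcount, h, Nat.card_coe_set_eq, Set.ncard_coe_finset]

lemma card_ghostTrees_empty (g m : ℕ) (Y : Finset ℕ) : (ghostTrees g ∅ m Y).card = 1 := by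
  rw [Finset.card_eq_one]
  refine ⟨(∅, 0), ?_⟩
  ext ⟨E, t⟩
  rw [mem_ghostTrees, Finset.mem_singleton, Prod.mk.injEq]
  constructor
  · rintro ⟨-, h0, ⟨-, -, -, hc⟩, -⟩
    exact ⟨by simpa using hc, funext fun v => h0 v (Finset.notMem_empty v)⟩
  · rintro ⟨rfl, rfl⟩
    refine ⟨by simp, by simp, ⟨by simp, by simp, ?_, by simp⟩, by simp, by simp⟩
    intro a ha b hb
    simp only [insert_empty_eq, Finset.mem_singleton] at ha hb
    rw [ha, hb]
    exact Relation.ReflTransGen.refl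

/-- Removing the tier of the least vertex. -/
lemma card_tieredTrees_insert (g : ℕ) (V : Finset ℕ) (m : ℕ) (hg : ∀ v ∈ V, g < v) :
    (tieredTrees (insert g V) m).card
      = ∑ j ∈ Finset.Icc 1 m, (ghostTrees g V m (Finset.Ioc j m)).card := by
  have hgV : g ∉ V := fun h => (hg g h).false
  rw [Finset.card_eq_sum_card_fiberwise (f := fun p => p.2 g) (t := Finset.Icc 1 m)
    (fun p hp => (mem_tieredTrees.mp hp).1 g (Finset.mem_insert_self _ _))]
  refine Finset.sum_congr rfl fun j hj => ?_
  refine Finset.card_bij' (fun p _ => (p.1, Function.update p.2 g 0))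
    (fun p _ => (p.1, Function.update p.2 g j)) ?_ ?_ ?_ ?_
  · rintro ⟨E, t⟩ hp
    rw [Finset.mem_filter, mem_tieredTrees] at hp
    obtain ⟨⟨h1, h2, h3, h4⟩, h5⟩ := hp
    dsimp only at h1 h2 h3 h4 h5
    rw [mem_ghostTrees]
    have hne : ∀ v ∈ V, v ≠ g := fun v hv => (hg v hv).ne'
    refine ⟨fun v hv => ?_, fun v hv => ?_, h3, fun a b hab ha hb hlt => ?_, fun u hu => ?_⟩
    · simpa [hne v hv] using h1 v (Finset.mem_insert_of_mem hv)
    · by_cases hvg : v = g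
      · simp [hvg]
      · simpa [hvg] using h2 v (by simp [hvg, hv])
    · simpa [ha, hb] using h4 a b hab hlt
    · have hug : u ≠ g := by
        rintro rfl
        exact h3.2.1 _ hu (Sym2.mk_isDiag_iff.mpr rfl)
      have huV : u ∈ insert g V := h3.1 _ hu u (Sym2.mem_mk_right _ _)
      have hlt := h4 g u hu (hg u (Finset.mem_of_mem_insert_of_ne huV hug))
      have := Finset.mem_Icc.mp (h1 u huV)
      simp only [Function.update_of_ne hug, Finset.mem_Ioc]
      omega
  · rintro ⟨E, t⟩ hp
    rw [mem_ghostTrees] at hp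
    obtain ⟨h1, h2, h3, h4, h5⟩ := hp
    dsimp only at h1 h2 h3 h4 h5
    rw [Finset.mem_filter, mem_tieredTrees]
    refine ⟨⟨fun v hv => ?_, fun v hv => ?_, h3, fun a b hab hlt => ?_⟩, by simp⟩
    · rcases Finset.mem_insert.mp hv with rfl | hv
      · simpa using hj
      · simpa [(hg v hv).ne'] using h1 v hv
    · simp only [Finset.mem_insert, not_or] at hv
      simpa [hv.1] using h2 v hv.2
    · have hbV : b ∈ insert g V := h3.1 _ hab b (Sym2.mem_mk_right _ _)
      have haV : a ∈ insert g V := h3.1 _ hab a (Sym2.mem_mk_left _ _)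
      have hb : b ≠ g := by
        rintro rfl
        have := hg a (Finset.mem_of_mem_insert_of_ne haV hlt.ne)
        omega
      by_cases ha : a = g
      · subst ha
        have := h5 b hab
        simp only [Finset.mem_Ioc] at this
        simpa [hb] using this.1
      · simpa [ha, hb] using h4 a b hab ha hb hlt
  · rintro ⟨E, t⟩ hp
    have h5 : t g = j := (Finset.mem_filter.mp hp).2
    simp [← h5]
  · rintro ⟨E, t⟩ hp
    have h0 : t g = 0 := (mem_ghostTrees.mp hp).2.1 g hgV
    simp [← h0]

lemma IsTreeOn.mem_left {V : Finset ℕ} {E : Finset (Sym2 ℕ)} (h : IsTreeOn V E) {a b : ℕ}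
    (hab : s(a, b) ∈ E) : a ∈ V :=
  h.1 _ hab a (Sym2.mem_mk_left _ _)

lemma IsTreeOn.mem_right {V : Finset ℕ} {E : Finset (Sym2 ℕ)} (h : IsTreeOn V E) {a b : ℕ}
    (hab : s(a, b) ∈ E) : b ∈ V :=
  h.1 _ hab b (Sym2.mem_mk_right _ _)

/-- The vertices of `V` that can be reached from `v` without passing through `g`. -/
noncomputable def branch (g : ℕ) (V : Finset ℕ) (v : ℕ) (E : Finset (Sym2 ℕ)) : Finset ℕ :=
  V.filter fun x => EReach (E.filter fun e => g ∉ e) v x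

/-- Splitting off the branch of `v` from a tree with an additional vertex `g`. -/
lemma IsTreeOn.split_branch {g v : ℕ} {V : Finset ℕ} {E : Finset (Sym2 ℕ)} (hg : g ∉ V)
    (hv : v ∈ V) (hT : IsTreeOn (insert g V) E) {S : Finset ℕ} (hS : branch g V v E = S) :
    IsTreeOn (insert g (V \ S)) (edgesWithin E (insert g (V \ S))) ∧
      IsTreeOn S (edgesWithin E S) ∧ ∃ u ∈ S,
        E = insert s(g, u) (edgesWithin E (insert g (V \ S)) ∪ edgesWithin E S) := by
  have hmem : ∀ x, x ∈ S ↔ x ∈ V ∧ EReach (E.filter fun e => g ∉ e) v x := by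
    intro x
    rw [← hS, branch, Finset.mem_filter]
  have hvS : v ∈ S := (hmem v).mpr ⟨hv, Relation.ReflTransGen.refl⟩
  have hgS : g ∉ S := fun h => hg ((hmem g).mp h).1
  have hSV : S ⊆ V := fun x hx => ((hmem x).mp hx).1
  have hstep : ∀ x y, s(x, y) ∈ E → x ∈ S → y ≠ g → y ∈ S := by
    intro x y hxy hx hy
    obtain ⟨-, hx2⟩ := (hmem x).mp hx
    refine (hmem y).mpr ⟨Finset.mem_of_mem_insert_of_ne (hT.mem_right hxy) hy, hx2.tail ?_⟩
    rw [Finset.mem_filter, Sym2.mem_iff]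
    refine ⟨hxy, ?_⟩
    rintro (rfl | rfl)
    · exact hgS hx
    · exact hy rfl
  have hcover : insert g (V \ S) ∪ S = insert g V := by
    rw [Finset.insert_union, Finset.sdiff_union_of_subset hSV]
  have hdisj : Disjoint (insert g (V \ S)) S := by
    rw [Finset.disjoint_insert_left]
    exact ⟨hgS, Finset.sdiff_disjoint⟩
  have hconnS : ∀ a ∈ S, EReach (edgesWithin E S) v a := by
    intro a ha
    have key : ∀ b, EReach (E.filter fun e => g ∉ e) v b →
        b ∈ S ∧ EReach (edgesWithin E S) v b := by
      intro b hb
      induction hb with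
      | refl => exact ⟨hvS, Relation.ReflTransGen.refl⟩
      | @tail c d _ hcd ih =>
        rw [Finset.mem_filter, Sym2.mem_iff, not_or] at hcd
        have hd := hstep c d hcd.1 ih.1 (Ne.symm hcd.2.2)
        exact ⟨hd, ih.2.tail (mk_mem_edgesWithin.mpr ⟨hcd.1, ih.1, hd⟩)⟩
    exact (key a ((hmem a).mp ha).2).2
  have hconnA : ∀ a ∈ insert g (V \ S), EReach (edgesWithin E (insert g (V \ S))) g a := by
    intro a ha
    have key : ∀ b, EReach E g b → b ∈ S ∨ EReach (edgesWithin E (insert g (V \ S))) g b := by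
      intro b hb
      induction hb with
      | refl => exact Or.inr Relation.ReflTransGen.refl
      | @tail c d _ hcd ih =>
        by_cases hdg : d = g
        · exact Or.inr (hdg ▸ Relation.ReflTransGen.refl)
        by_cases hdS : d ∈ S
        · exact Or.inl hdS
        have hcS : c ∉ S := fun hc => hdS (hstep c d hcd hc hdg)
        have hout : ∀ x ∈ insert g V, x ∉ S → x ∈ insert g (V \ S) := by
          intro x hx hxS
          simp only [Finset.mem_insert, Finset.mem_sdiff] at hx ⊢
          tauto
        exact Or.inr ((ih.resolve_left hcS).tail (mk_mem_edgesWithin.mpr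
          ⟨hcd, hout c (hT.mem_left hcd) hcS, hout d (hT.mem_right hcd) hdS⟩))
    refine (key a (hT.2.2.1 g (Finset.mem_insert_self _ _) a ?_)).resolve_left
      (Finset.disjoint_left.mp hdisj ha)
    rw [← hcover]
    exact Finset.mem_union_left _ ha
  obtain ⟨h1, h2, a, ha, u, hu, hE⟩ := IsTreeOn.split (hcover.symm ▸ hT) hdisj
    ⟨g, Finset.mem_insert_self _ _⟩ ⟨v, hvS⟩
    (fun a ha b hb => (hconnA a ha).symm.trans (hconnA b hb))
    (fun a ha b hb => (hconnS a ha).symm.trans (hconnS b hb))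
  refine ⟨h1, h2, u, hu, ?_⟩
  have hag : a = g := by
    by_contra hne
    have hau : s(u, a) ∈ E := by
      rw [Sym2.eq_swap, hE]
      exact Finset.mem_insert_self _ _
    exact Finset.disjoint_left.mp hdisj ha (hstep u a hau hu hne)
  rwa [hag] at hE

/-- The edges of two disjoint trees can be recovered after joining them by an edge. -/
lemma edgesWithin_glue {A B : Finset ℕ} {E F : Finset (Sym2 ℕ)} (hA : IsTreeOn A E)
    (hB : IsTreeOn B F) (hAB : Disjoint A B) {a b : ℕ} (ha : a ∈ A) (hb : b ∈ B) :
    edgesWithin (insert s(a, b) (E ∪ F)) A = E ∧ edgesWithin (insert s(a, b) (E ∪ F)) B = F := by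
  have hnot := Finset.disjoint_left.mp hAB
  constructor
  · ext e
    induction e with | _ x y
    rw [mk_mem_edgesWithin, Finset.mem_insert, Finset.mem_union]
    constructor
    · rintro ⟨h | h | h, hx, hy⟩
      · rcases Sym2.eq_iff.mp h with ⟨rfl, rfl⟩ | ⟨rfl, rfl⟩
        · exact absurd hb (hnot hy)
        · exact absurd hb (hnot hx)
      · exact h
      · exact absurd (hB.mem_left h) (hnot hx)
    · exact fun h => ⟨Or.inr (Or.inl h), hA.mem_left h, hA.mem_right h⟩
  · ext e
    induction e with | _ x y
    rw [mk_mem_edgesWithin, Finset.mem_insert, Finset.mem_union]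
    constructor
    · rintro ⟨h | h | h, hx, hy⟩
      · rcases Sym2.eq_iff.mp h with ⟨rfl, rfl⟩ | ⟨rfl, rfl⟩
        · exact absurd hx (hnot ha)
        · exact absurd hy (hnot ha)
      · exact absurd hx (hnot (hA.mem_left h))
      · exact h
    · exact fun h => ⟨Or.inr (Or.inr h), hB.mem_left h, hB.mem_right h⟩

lemma branch_glue {g v u : ℕ} {V S : Finset ℕ} {E F : Finset (Sym2 ℕ)} (hg : g ∉ V) (hSV : S ⊆ V)
    (hv : v ∈ S) (hA : IsTreeOn (insert g (V \ S)) E) (hB : IsTreeOn S F) (hu : u ∈ S) :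
    branch g V v (insert s(g, u) (E ∪ F)) = S := by
  ext x
  rw [branch, Finset.mem_filter]
  constructor
  · rintro ⟨-, hx⟩
    refine hx.mem_of_closed (fun a b hab ha => ?_) hv
    simp only [Finset.mem_filter, Finset.mem_insert, Finset.mem_union, Sym2.mem_iff, not_or]
      at hab
    obtain ⟨h | h | h, hag, hbg⟩ := hab
    · rcases Sym2.eq_iff.mp h with ⟨rfl, rfl⟩ | ⟨rfl, rfl⟩
      · exact absurd rfl hag
      · exact absurd rfl hbg
    · have := Finset.mem_of_mem_insert_of_ne (hA.mem_left h) (Ne.symm hag)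
      exact absurd ha (Finset.mem_sdiff.mp this).2
    · exact hB.mem_right h
  · intro hx
    refine ⟨hSV hx, (hB.2.2.1 v hv x hx).mono fun e he => ?_⟩
    rw [Finset.mem_filter, Finset.mem_insert, Finset.mem_union]
    exact ⟨Or.inr (Or.inr he), fun hge => hg (hSV (hB.1 e he g hge))⟩

/-- Decomposition according to the branch of a given vertex. -/
lemma card_ghostTrees_eq_sum {g v : ℕ} {V : Finset ℕ} (m : ℕ) (Y : Finset ℕ) (hg : g ∉ V)
    (hv : v ∈ V) :
    (ghostTrees g V m Y).card
      = ∑ S ∈ V.powerset.filter (v ∈ ·),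
          (rootedTieredTrees S m Y).card * (ghostTrees g (V \ S) m Y).card := by
  rw [Finset.card_eq_sum_card_fiberwise (f := fun p => branch g V v p.1)
    (t := V.powerset.filter (v ∈ ·))]
  swap
  · intro p _
    simp only [Finset.coe_filter, Finset.mem_powerset, Set.mem_ofPred_eq]
    exact ⟨Finset.filter_subset _ _,
      Finset.mem_filter.mpr ⟨hv, Relation.ReflTransGen.refl⟩⟩
  refine Finset.sum_congr rfl fun S hS => ?_
  obtain ⟨hSV, hvS⟩ := Finset.mem_filter.mp hS
  rw [Finset.mem_powerset] at hSV
  have hgS : g ∉ S := fun h => hg (hSV h)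
  have hdisj : Disjoint (insert g (V \ S)) S := by
    rw [Finset.disjoint_insert_left]
    exact ⟨hgS, Finset.sdiff_disjoint⟩
  have hnot := Finset.disjoint_left.mp hdisj
  have hcover : insert g (V \ S) ∪ S = insert g V := by
    rw [Finset.insert_union, Finset.sdiff_union_of_subset hSV]
  rw [← Finset.card_product]
  symm
  refine Finset.card_bij
    (fun q _ => (insert s(g, q.1.2) (q.2.1 ∪ q.1.1.1), q.1.1.2 + q.2.2)) ?_ ?_ ?_
  · rintro ⟨⟨⟨F, t⟩, u⟩, E, r⟩ hq
    rw [Finset.mem_product, mem_rootedTieredTrees, mem_tieredTrees, mem_ghostTrees] at hq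
    obtain ⟨⟨⟨ht1, ht2, hF, ht3⟩, hu, huY⟩, hr1, hr2, hE, hr3, hr4⟩ := hq
    dsimp only at ht1 ht2 hF ht3 hu huY hr1 hr2 hE hr3 hr4
    have hr0 : ∀ x ∈ S, r x = 0 := fun x hx => hr2 x fun h => (Finset.mem_sdiff.mp h).2 hx
    rw [Finset.mem_filter, mem_ghostTrees]
    refine ⟨⟨fun x hx => ?_, fun x hx => ?_, ?_, ?_, ?_⟩, branch_glue hg hSV hvS hE hF hu⟩
    · by_cases hxS : x ∈ S
      · simpa [hr0 x hxS] using ht1 x hxS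
      · simpa [ht2 x hxS] using hr1 x (Finset.mem_sdiff.mpr ⟨hx, hxS⟩)
    · simp [ht2 x fun h => hx (hSV h), hr2 x fun h => hx (Finset.mem_sdiff.mp h).1]
    · exact hcover ▸ hE.glue hF hdisj (Finset.mem_insert_self _ _) hu
    · intro a b hab ha hb hlt
      simp only [Finset.mem_insert, Finset.mem_union] at hab
      obtain h | h | h := hab
      · rcases Sym2.eq_iff.mp h with ⟨rfl, rfl⟩ | ⟨rfl, rfl⟩
        · exact absurd rfl ha
        · exact absurd rfl hb
      · simpa [ht2 a (hnot (hE.mem_left h)), ht2 b (hnot (hE.mem_right h))]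
          using hr3 a b h ha hb hlt
      · simpa [hr0 a (hF.mem_left h), hr0 b (hF.mem_right h)] using ht3 a b h hlt
    · intro x hx
      simp only [Finset.mem_insert, Finset.mem_union] at hx
      obtain h | h | h := hx
      · rcases Sym2.eq_iff.mp h with ⟨-, rfl⟩ | ⟨rfl, rfl⟩
        · simpa [hr0 x hu] using huY
        · exact absurd hu hgS
      · simpa [ht2 x (hnot (hE.mem_right h))] using hr4 x h
      · exact absurd (hF.mem_left h) hgS
  · rintro ⟨⟨⟨F, t⟩, u⟩, E, r⟩ hq ⟨⟨⟨F', t'⟩, u'⟩, E', r'⟩ hq' heq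
    rw [Finset.mem_product, mem_rootedTieredTrees, mem_tieredTrees, mem_ghostTrees] at hq hq'
    obtain ⟨⟨⟨-, ht2, hF, -⟩, hu, -⟩, -, hr2, hE, -, -⟩ := hq
    obtain ⟨⟨⟨-, ht2', hF', -⟩, hu', -⟩, -, hr2', hE', -, -⟩ := hq'
    dsimp only at ht2 hF hu hr2 hE ht2' hF' hu' hr2' hE'
    rw [Prod.mk.injEq] at heq
    obtain ⟨heq1, heq2⟩ := heq
    dsimp only at heq1 heq2
    have hg' : g ∈ insert g (V \ S) := Finset.mem_insert_self _ _
    obtain ⟨e1, e2⟩ := edgesWithin_glue hE hF hdisj hg' hu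
    obtain ⟨e1', e2'⟩ := edgesWithin_glue hE' hF' hdisj hg' hu'
    rw [heq1, e1'] at e1
    rw [heq1, e2'] at e2
    have hu2 : u = u' := by
      have hmem : s(g, u) ∈ insert s(g, u') (E' ∪ F') :=
        heq1 ▸ Finset.mem_insert_self _ _
      simp only [Finset.mem_insert, Finset.mem_union] at hmem
      obtain h | h | h := hmem
      · exact Sym2.congr_right.mp h
      · exact absurd hu (hnot (hE'.mem_right h))
      · exact absurd (hF'.mem_left h) hgS
    have hpt : ∀ x, t x = t' x ∧ r x = r' x := by
      intro x
      have hx := congrFun heq2 x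
      simp only [Pi.add_apply] at hx
      by_cases hxS : x ∈ S
      · have hxn : x ∉ V \ S := fun h => (Finset.mem_sdiff.mp h).2 hxS
        rw [hr2 x hxn, hr2' x hxn] at hx ⊢
        exact ⟨hx, rfl⟩
      · rw [ht2 x hxS, ht2' x hxS] at hx ⊢
        exact ⟨rfl, by omega⟩
    rw [e1, e2, hu2, funext fun x => (hpt x).1, funext fun x => (hpt x).2]
  · rintro ⟨E, t⟩ hp
    rw [Finset.mem_filter, mem_ghostTrees] at hp
    obtain ⟨⟨h1, h2, hT, h3, h4⟩, h5⟩ := hp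
    dsimp only at h1 h2 hT h3 h4 h5
    obtain ⟨hA, hB, u, hu, hE⟩ := hT.split_branch hg hv h5
    have huE : s(g, u) ∈ E := by
      rw [hE]
      exact Finset.mem_insert_self _ _
    refine ⟨(((edgesWithin E S, fun x => if x ∈ S then t x else 0), u),
      (edgesWithin E (insert g (V \ S)), fun x => if x ∈ S then 0 else t x)), ?_, ?_⟩
    · rw [Finset.mem_product, mem_rootedTieredTrees, mem_tieredTrees, mem_ghostTrees]
      refine ⟨⟨⟨fun x hx => ?_, fun x hx => ?_, hB, fun a b hab hlt => ?_⟩, hu, ?_⟩,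
        fun x hx => ?_, fun x hx => ?_, hA, fun a b hab ha hb hlt => ?_, fun x hx => ?_⟩
      · simpa [hx] using h1 x (hSV hx)
      · simp [hx]
      · rw [mk_mem_edgesWithin] at hab
        simpa [hab.2.1, hab.2.2] using h3 a b hab.1 (fun h => hgS (h ▸ hab.2.1))
          (fun h => hgS (h ▸ hab.2.2)) hlt
      · simpa [hu] using h4 u huE
      · rw [Finset.mem_sdiff] at hx
        simpa [hx.2] using h1 x hx.1
      · by_cases hxS : x ∈ S
        · simp [hxS]
        · simpa [hxS] using h2 x fun h => hx (Finset.mem_sdiff.mpr ⟨h, hxS⟩)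
      · rw [mk_mem_edgesWithin] at hab
        simpa [hnot hab.2.1, hnot hab.2.2] using h3 a b hab.1 ha hb hlt
      · rw [mk_mem_edgesWithin] at hx
        simpa [hnot hx.2.2] using h4 x hx.1
    · refine Prod.ext hE.symm (funext fun x => ?_)
      by_cases hxS : x ∈ S <;> simp [hxS]

/-! ### Symmetry of the tiers -/

/-- The tiers `j` and `j + 1`. -/
abbrev midTier (j k : ℕ) : Prop := k = j ∨ k = j + 1

/-- The variant of tiered trees in which edges between vertices of tiers `j` and `j + 1` are
oriented by the relation `r`, and all other edges by the usual order of the labels. -/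
noncomputable def twistedTrees (r : ℕ → ℕ → Prop) (j : ℕ) (V : Finset ℕ) (m : ℕ) :
    Finset (Finset (Sym2 ℕ) × (ℕ → ℕ)) :=
  (labeledGraphSet_finite V V m).toFinset.filter fun p =>
    IsTreeOn V p.1 ∧
      (∀ a b, s(a, b) ∈ p.1 → midTier j (p.2 a) → midTier j (p.2 b) → r a b → p.2 a < p.2 b) ∧
      ∀ a b, s(a, b) ∈ p.1 → ¬ (midTier j (p.2 a) ∧ midTier j (p.2 b)) → a < b → p.2 a < p.2 b

lemma mem_twistedTrees {r : ℕ → ℕ → Prop} {j : ℕ} {V : Finset ℕ} {m : ℕ}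
    {p : Finset (Sym2 ℕ) × (ℕ → ℕ)} :
    p ∈ twistedTrees r j V m ↔
      (∀ v ∈ V, p.2 v ∈ Finset.Icc 1 m) ∧ (∀ v, v ∉ V → p.2 v = 0) ∧ IsTreeOn V p.1 ∧
      (∀ a b, s(a, b) ∈ p.1 → midTier j (p.2 a) → midTier j (p.2 b) → r a b → p.2 a < p.2 b) ∧
      ∀ a b, s(a, b) ∈ p.1 → ¬ (midTier j (p.2 a) ∧ midTier j (p.2 b)) → a < b →
        p.2 a < p.2 b := by
  simp only [twistedTrees, labeledGraphSet, Finset.mem_filter, Set.Finite.mem_toFinset,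
    Set.mem_ofPred_eq]
  exact ⟨fun h => ⟨h.1.2.1, h.1.2.2, h.2⟩, fun h => ⟨⟨h.2.2.1.1, h.1, h.2.1⟩, h.2.2⟩⟩

lemma twistedTrees_lt (j : ℕ) (V : Finset ℕ) (m : ℕ) :
    twistedTrees (· < ·) j V m = tieredTrees V m := by
  ext p
  rw [mem_twistedTrees, mem_tieredTrees]
  refine and_congr_right fun _ => and_congr_right fun _ => and_congr_right fun _ =>
    ⟨fun h a b hab hlt => ?_, fun h => ⟨fun a b hab _ _ => h a b hab, fun a b hab _ => h a b hab⟩⟩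
  by_cases hm : midTier j (p.2 a) ∧ midTier j (p.2 b)
  · exact h.1 a b hab hm.1 hm.2 hlt
  · exact h.2 a b hab hm hlt

/-- The number of vertices of tier `c` in all twisted trees. -/
noncomputable def twistedTierCount (r : ℕ → ℕ → Prop) (j : ℕ) (V : Finset ℕ) (m c : ℕ) : ℕ :=
  ∑ p ∈ twistedTrees r j V m, (V.filter fun v => p.2 v = c).card

/-- Exchange `b` and `b'` in the pairs whose members all satisfy `D`. -/
noncomputable def swapWithin (D : ℕ → Prop) (b b' : ℕ) (e : Sym2 ℕ) : Sym2 ℕ :=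
  if ∀ x ∈ e, D x then e.map (Equiv.swap b b') else e

lemma swap_pred_iff {D : ℕ → Prop} {b b' : ℕ} (h : D b ↔ D b') (x : ℕ) :
    D (Equiv.swap b b' x) ↔ D x := by
  rw [Equiv.swap_apply_def]
  split_ifs with h1 h2
  · rw [h1, h]
  · rw [h2, h]
  · rfl

lemma swapWithin_mk (D : ℕ → Prop) (b b' x y : ℕ) : swapWithin D b b' s(x, y) =
    if D x ∧ D y then s(Equiv.swap b b' x, Equiv.swap b b' y) else s(x, y) := by
  simp [swapWithin]

lemma swapWithin_swapWithin {D : ℕ → Prop} {b b' : ℕ} (h : D b ↔ D b') (e : Sym2 ℕ) :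
    swapWithin D b b' (swapWithin D b b' e) = e := by
  induction e with
  | _ x y =>
    by_cases hxy : D x ∧ D y
    · rw [swapWithin_mk, if_pos hxy, swapWithin_mk, if_pos, Equiv.swap_apply_self,
        Equiv.swap_apply_self]
      rwa [swap_pred_iff h, swap_pred_iff h]
    · rw [swapWithin_mk, if_neg hxy, swapWithin_mk, if_neg hxy]

lemma mem_image_swapWithin {D : ℕ → Prop} {b b' : ℕ} (h : D b ↔ D b') {E : Finset (Sym2 ℕ)}
    {e : Sym2 ℕ} : e ∈ E.image (swapWithin D b b') ↔ swapWithin D b b' e ∈ E := by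
  rw [Finset.mem_image]
  constructor
  · rintro ⟨e, he, rfl⟩
    rwa [swapWithin_swapWithin h]
  · exact fun he => ⟨_, he, swapWithin_swapWithin h e⟩

lemma IsTreeOn.image_swapWithin {V : Finset ℕ} {E : Finset (Sym2 ℕ)} (hT : IsTreeOn V E)
    {D : ℕ → Prop} {b b' : ℕ} (hb : D b) (hb' : D b') (hE : s(b, b') ∈ E) :
    IsTreeOn V (E.image (swapWithin D b b')) := by
  have hD : D b ↔ D b' := iff_of_true hb hb'
  have hbV := hT.1 _ hE b (Sym2.mem_mk_left _ _)
  have hbV' := hT.1 _ hE b' (Sym2.mem_mk_right _ _)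
  refine ⟨?_, ?_, ?_, ?_⟩
  · intro e he x hx
    rw [mem_image_swapWithin hD] at he
    obtain ⟨y, rfl⟩ := Sym2.mem_iff_exists.mp hx
    rw [swapWithin_mk] at he
    split_ifs at he
    · exact (swap_pred_iff (D := (· ∈ V)) (iff_of_true hbV hbV') x).mp
        (hT.1 _ he _ (Sym2.mem_mk_left _ _))
    · exact hT.1 _ he _ (Sym2.mem_mk_left _ _)
  · intro e he
    rw [mem_image_swapWithin hD] at he
    induction e with
    | _ x y =>
      rw [swapWithin_mk] at he
      rw [Sym2.mk_isDiag_iff]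
      rintro rfl
      split_ifs at he <;> exact hT.2.1 _ he (Sym2.mk_isDiag_iff.mpr rfl)
  · have hmid : EReach (E.image (swapWithin D b b')) b b' := by
      refine EReach.of_mem ?_
      rwa [mem_image_swapWithin hD, swapWithin_mk, if_pos ⟨hb, hb'⟩, Equiv.swap_apply_left,
        Equiv.swap_apply_right, Sym2.eq_swap]
    have hswap : ∀ x, EReach (E.image (swapWithin D b b')) x (Equiv.swap b b' x) := by
      intro x
      rw [Equiv.swap_apply_def]
      split_ifs with h1 h2
      · exact h1 ▸ hmid
      · exact h2 ▸ hmid.symm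
      · exact Relation.ReflTransGen.refl
    intro x hx y hy
    have hxy := hT.2.2.1 x hx y hy
    clear hy
    induction hxy with
    | refl => exact Relation.ReflTransGen.refl
    | @tail c d _ hcd ih =>
      refine ih.trans ?_
      have hmem : swapWithin D b b' s(c, d) ∈ E.image (swapWithin D b b') :=
        Finset.mem_image_of_mem _ hcd
      rw [swapWithin_mk] at hmem
      split_ifs at hmem
      · exact (hswap c).trans ((EReach.of_mem hmem).trans (hswap d).symm)
      · exact EReach.of_mem hmem
  · rw [Finset.card_image_of_injective _
      (Function.LeftInverse.injective (swapWithin_swapWithin hD))]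
    exact hT.2.2.2

/-- Exchange `b` and `b'` in the part of the tree spanned by the tiers `j` and `j + 1`, provided
they are adjacent there. -/
noncomputable def exchange (j b b' : ℕ) (p : Finset (Sym2 ℕ) × (ℕ → ℕ)) :
    Finset (Sym2 ℕ) × (ℕ → ℕ) :=
  if s(b, b') ∈ p.1 ∧ midTier j (p.2 b) ∧ midTier j (p.2 b') then
    (p.1.image (swapWithin (fun x => midTier j (p.2 x)) b b'), p.2 ∘ Equiv.swap b b')
  else p

lemma exchange_exchange (j b b' : ℕ) (p : Finset (Sym2 ℕ) × (ℕ → ℕ)) :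
    exchange j b b' (exchange j b b' p) = p := by
  obtain ⟨E, t⟩ := p
  by_cases h : s(b, b') ∈ E ∧ midTier j (t b) ∧ midTier j (t b')
  · obtain ⟨hE, hb, hb'⟩ := h
    have hD : midTier j (t b) ↔ midTier j (t b') := iff_of_true hb hb'
    have hfun : (fun x => midTier j ((t ∘ Equiv.swap b b') x)) = fun x => midTier j (t x) :=
      funext fun x => propext (swap_pred_iff (D := fun x => midTier j (t x)) hD x)
    have hmem : s(b, b') ∈ E.image (swapWithin (fun x => midTier j (t x)) b b') := by
      rwa [mem_image_swapWithin (D := fun x => midTier j (t x)) hD, swapWithin_mk,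
        if_pos ⟨hb, hb'⟩, Equiv.swap_apply_left, Equiv.swap_apply_right, Sym2.eq_swap]
    have h1 : exchange j b b' (E, t) =
        (E.image (swapWithin (fun x => midTier j (t x)) b b'), t ∘ Equiv.swap b b') :=
      if_pos ⟨hE, hb, hb'⟩
    rw [h1, exchange, if_pos]
    · dsimp only
      rw [hfun, Finset.image_image, Prod.mk.injEq]
      constructor
      · have hid : swapWithin (fun x => midTier j (t x)) b b' ∘
            swapWithin (fun x => midTier j (t x)) b b' = id :=
          funext (swapWithin_swapWithin (D := fun x => midTier j (t x)) hD)
        rw [hid, Finset.image_id]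
      · funext x
        simp
    · exact ⟨hmem, by simpa using hb', by simpa using hb⟩
  · have h1 : exchange j b b' (E, t) = (E, t) := if_neg h
    rw [h1, h1]

lemma exchange_mem_twistedTrees {r r' : ℕ → ℕ → Prop} {j b b' : ℕ} {V : Finset ℕ} {m : ℕ}
    (hr : ∀ x y, r' x y → r (Equiv.swap b b' x) (Equiv.swap b b' y))
    (hr' : ∀ x y, x ≠ y → s(x, y) ≠ s(b, b') → r' x y → r x y)
    {p : Finset (Sym2 ℕ) × (ℕ → ℕ)} (hp : p ∈ twistedTrees r j V m) :
    exchange j b b' p ∈ twistedTrees r' j V m := by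
  obtain ⟨E, t⟩ := p
  rw [mem_twistedTrees] at hp
  obtain ⟨h1, h2, h3, h4, h5⟩ := hp
  dsimp only at h1 h2 h3 h4 h5
  by_cases h : s(b, b') ∈ E ∧ midTier j (t b) ∧ midTier j (t b')
  · have hex : exchange j b b' (E, t) =
        (E.image (swapWithin (fun x => midTier j (t x)) b b'), t ∘ Equiv.swap b b') := if_pos h
    obtain ⟨hE, hb, hb'⟩ := h
    have hD : midTier j (t b) ↔ midTier j (t b') := iff_of_true hb hb'
    have hDx := swap_pred_iff (D := fun x => midTier j (t x)) hD
    have hVx := swap_pred_iff (D := (· ∈ V)) (iff_of_true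
      (h3.1 _ hE b (Sym2.mem_mk_left _ _)) (h3.1 _ hE b' (Sym2.mem_mk_right _ _)))
    have htx : ∀ x, t (Equiv.swap b b' x) = t x ∨
        midTier j (t x) ∧ midTier j (t (Equiv.swap b b' x)) := by
      intro x
      rw [Equiv.swap_apply_def]
      split_ifs with h1 h2
      · exact Or.inr ⟨h1 ▸ hb, hb'⟩
      · exact Or.inr ⟨h2 ▸ hb', hb⟩
      · exact Or.inl rfl
    rw [hex, mem_twistedTrees]
    refine ⟨fun v hv => h1 _ ((hVx v).mpr hv), fun v hv => h2 _ (mt (hVx v).mp hv),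
      h3.image_swapWithin (D := fun x => midTier j (t x)) hb hb' hE, ?_, ?_⟩
    · intro x y hxy hx hy hlt
      have hxy' := (mem_image_swapWithin (D := fun x => midTier j (t x)) hD).mp hxy
      rw [swapWithin_mk, if_pos ⟨(hDx x).mp hx, (hDx y).mp hy⟩] at hxy'
      exact h4 _ _ hxy' hx hy (hr x y hlt)
    · intro x y hxy hn hlt
      have hn' : ¬ (midTier j (t x) ∧ midTier j (t y)) :=
        fun h => hn ⟨(hDx x).mpr h.1, (hDx y).mpr h.2⟩
      have hxy' := (mem_image_swapWithin (D := fun x => midTier j (t x)) hD).mp hxy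
      rw [swapWithin_mk, if_neg hn'] at hxy'
      have := h5 x y hxy' hn' hlt
      have hx := htx x
      have hy := htx y
      simp only [Function.comp_apply, midTier] at hx hy hn' ⊢
      omega
  · have hex : exchange j b b' (E, t) = (E, t) := if_neg h
    rw [hex, mem_twistedTrees]
    refine ⟨h1, h2, h3, fun x y hxy hx hy hlt => h4 x y hxy hx hy (hr' x y ?_ ?_ hlt), h5⟩
    · rintro rfl
      exact h3.2.1 _ hxy (Sym2.mk_isDiag_iff.mpr rfl)
    · intro he
      rcases Sym2.eq_iff.mp he with ⟨rfl, rfl⟩ | ⟨rfl, rfl⟩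
      · exact h ⟨hxy, hx, hy⟩
      · exact h ⟨Sym2.eq_swap ▸ hxy, hy, hx⟩

lemma card_filter_exchange {r : ℕ → ℕ → Prop} {j b b' : ℕ} {V : Finset ℕ} {m : ℕ} (c : ℕ)
    {p : Finset (Sym2 ℕ) × (ℕ → ℕ)} (hp : p ∈ twistedTrees r j V m) :
    (V.filter fun v => (exchange j b b' p).2 v = c).card = (V.filter fun v => p.2 v = c).card := by
  obtain ⟨E, t⟩ := p
  rw [mem_twistedTrees] at hp
  have h3 : IsTreeOn V E := hp.2.2.1
  by_cases h : s(b, b') ∈ E ∧ midTier j (t b) ∧ midTier j (t b')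
  · have hex : exchange j b b' (E, t) =
        (E.image (swapWithin (fun x => midTier j (t x)) b b'), t ∘ Equiv.swap b b') := if_pos h
    have hVx := swap_pred_iff (D := (· ∈ V)) (iff_of_true
      (h3.1 _ h.1 b (Sym2.mem_mk_left _ _)) (h3.1 _ h.1 b' (Sym2.mem_mk_right _ _)))
    rw [hex]
    refine Finset.card_equiv (Equiv.swap b b') fun x => ?_
    simp [hVx x]
  · have hex : exchange j b b' (E, t) = (E, t) := if_neg h
    rw [hex]

/-- Exchanging two neighbours in the relation `r` does not change the tier counts. -/
lemma twistedTierCount_exchange {r r' : ℕ → ℕ → Prop} {b b' : ℕ}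
    (hr : ∀ x y, r' x y ↔ r (Equiv.swap b b' x) (Equiv.swap b b' y))
    (hr' : ∀ x y, x ≠ y → s(x, y) ≠ s(b, b') → (r' x y ↔ r x y))
    (j : ℕ) (V : Finset ℕ) (m c : ℕ) :
    twistedTierCount r' j V m c = twistedTierCount r j V m c := by
  refine (Finset.sum_bij' (fun p _ => exchange j b b' p) (fun p _ => exchange j b b' p)
    (fun p hp => ?_) (fun p hp => ?_) (fun p _ => exchange_exchange j b b' p)
    (fun p _ => exchange_exchange j b b' p) fun p hp => (card_filter_exchange c hp).symm).symm
  · exact exchange_mem_twistedTrees (fun x y => (hr x y).mp)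
      (fun x y hxy hne => (hr' x y hxy hne).mp) hp
  · refine exchange_mem_twistedTrees (fun x y h => ?_)
      (fun x y hxy hne => (hr' x y hxy hne).mpr) hp
    rw [hr]
    simpa using h

lemma twistedTierCount_swap_mul (i : ℕ) (π : Equiv.Perm ℕ) (j : ℕ) (V : Finset ℕ) (m c : ℕ) :
    twistedTierCount (fun a b => (Equiv.swap i (i + 1) * π) a < (Equiv.swap i (i + 1) * π) b)
      j V m c = twistedTierCount (fun a b => π a < π b) j V m c := by
  refine twistedTierCount_exchange (b := π.symm i) (b' := π.symm (i + 1)) (fun x y => ?_)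
    (fun x y hxy hne => ?_) j V m c
  · have h : ∀ x, π (Equiv.swap (π.symm i) (π.symm (i + 1)) x) = Equiv.swap i (i + 1) (π x) := by
      intro x
      rw [← Equiv.Perm.mul_apply, Equiv.mul_swap_eq_swap_mul]
      simp
    simp [h]
  · have h1 : π x ≠ π y := fun h => hxy (π.injective h)
    have h2 : ¬ (π x = i ∧ π y = i + 1) := by
      rintro ⟨rfl, h⟩
      exact hne (by simp [← h])
    have h3 : ¬ (π x = i + 1 ∧ π y = i) := by
      rintro ⟨h, rfl⟩
      exact hne (by simp [← h, Sym2.eq_swap])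
    simp only [Equiv.Perm.mul_apply, Equiv.swap_apply_def]
    split_ifs <;> omega

lemma viaEmbedding_swap_valEmbedding {n : ℕ} (a b : Fin n) :
    (Equiv.swap a b).viaEmbedding Fin.valEmbedding = Equiv.swap (a : ℕ) b := by
  ext x
  by_cases hx : x < n
  · have h := Equiv.Perm.viaEmbedding_apply (Equiv.swap a b) Fin.valEmbedding ⟨x, hx⟩
    simp only [Fin.valEmbedding_apply] at h
    rw [h, Equiv.swap_apply_def, Equiv.swap_apply_def]
    simp only [Fin.ext_iff]
    split_ifs <;> rfl
  · rw [Equiv.Perm.viaEmbedding_apply_of_notMem, Equiv.swap_apply_of_ne_of_ne]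
    · omega
    · omega
    · simpa using hx

/-- Any reordering of the labels leaves the tier counts unchanged. -/
lemma twistedTierCount_viaEmbedding {n : ℕ} (π : Equiv.Perm (Fin (n + 1))) (j : ℕ)
    (V : Finset ℕ) (m c : ℕ) :
    twistedTierCount (fun a b => π.viaEmbedding Fin.valEmbedding a <
      π.viaEmbedding Fin.valEmbedding b) j V m c = twistedTierCount (· < ·) j V m c := by
  have hπ : π ∈ Submonoid.closure (Set.range fun i : Fin n => Equiv.swap i.castSucc i.succ) := by
    rw [Equiv.Perm.mclosure_swap_castSucc_succ]
    exact Submonoid.mem_top π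
  induction hπ using Submonoid.closure_induction_left with
  | one =>
    have h : (1 : Equiv.Perm (Fin (n + 1))).viaEmbedding Fin.valEmbedding = 1 :=
      map_one (Equiv.Perm.viaEmbeddingHom Fin.valEmbedding)
    simp [h]
  | mul_left s hs τ _ ih =>
    obtain ⟨i, rfl⟩ := hs
    have h : (Equiv.swap i.castSucc i.succ * τ).viaEmbedding Fin.valEmbedding =
        Equiv.swap (i : ℕ) (i + 1) * τ.viaEmbedding Fin.valEmbedding := by
      have := map_mul (Equiv.Perm.viaEmbeddingHom Fin.valEmbedding) (Equiv.swap i.castSucc i.succ) τ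
      simp only [Equiv.Perm.viaEmbeddingHom_apply] at this
      rw [this, viaEmbedding_swap_valEmbedding]
      simp
    dsimp only
    rw [h, twistedTierCount_swap_mul, ih]

/-- Reversing the order of the labels corresponds to exchanging the tiers `j` and `j + 1`. -/
lemma swap_comp_mem_twistedTrees {r r' : ℕ → ℕ → Prop} {j : ℕ} {V : Finset ℕ} {m : ℕ}
    (hj : 1 ≤ j) (hjm : j + 1 ≤ m) (hr : ∀ x ∈ V, ∀ y ∈ V, r' x y → r y x)
    {p : Finset (Sym2 ℕ) × (ℕ → ℕ)} (hp : p ∈ twistedTrees r j V m) :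
    (p.1, Equiv.swap j (j + 1) ∘ p.2) ∈ twistedTrees r' j V m := by
  have hmid : ∀ k, midTier j (Equiv.swap j (j + 1) k) ↔ midTier j k :=
    swap_pred_iff (D := midTier j) (iff_of_true (Or.inl rfl) (Or.inr rfl))
  rw [mem_twistedTrees] at hp ⊢
  obtain ⟨h1, h2, h3, h4, h5⟩ := hp
  refine ⟨fun v hv => ?_, fun v hv => ?_, h3, fun x y hxy hx hy hlt => ?_,
    fun x y hxy hn hlt => ?_⟩
  · have := Finset.mem_Icc.mp (h1 v hv)
    simp only [Finset.mem_Icc, Function.comp_apply, Equiv.swap_apply_def]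
    split_ifs <;> omega
  · dsimp only
    rw [Function.comp_apply, h2 v hv, Equiv.swap_apply_of_ne_of_ne] <;> omega
  · simp only [Function.comp_apply, hmid] at hx hy
    have := h4 y x (Sym2.eq_swap ▸ hxy) hy hx (hr x (h3.1 _ hxy x (Sym2.mem_mk_left _ _)) y
      (h3.1 _ hxy y (Sym2.mem_mk_right _ _)) hlt)
    simp only [Function.comp_apply, Equiv.swap_apply_def]
    simp only [midTier] at hx hy
    split_ifs <;> omega
  · simp only [Function.comp_apply, hmid] at hn
    have := h5 x y hxy hn hlt
    simp only [Function.comp_apply, Equiv.swap_apply_def]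
    simp only [midTier] at hn
    split_ifs <;> omega

lemma twistedTierCount_reverse {r r' : ℕ → ℕ → Prop} {j : ℕ} {V : Finset ℕ} {m : ℕ}
    (hj : 1 ≤ j) (hjm : j + 1 ≤ m) (hr : ∀ x ∈ V, ∀ y ∈ V, r' x y ↔ r y x) :
    twistedTierCount r' j V m j = twistedTierCount r j V m (j + 1) := by
  refine Finset.sum_bij' (fun p _ => (p.1, Equiv.swap j (j + 1) ∘ p.2))
    (fun p _ => (p.1, Equiv.swap j (j + 1) ∘ p.2))
    (fun p hp => swap_comp_mem_twistedTrees hj hjm (fun x hx y hy => (hr y hy x hx).mpr) hp)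
    (fun p hp => swap_comp_mem_twistedTrees hj hjm (fun x hx y hy => (hr x hx y hy).mp) hp)
    (fun p _ => ?_) (fun p _ => ?_) fun p _ => ?_
  · ext <;> simp
  · ext <;> simp
  · congr 1
    refine Finset.filter_congr fun v _ => ?_
    dsimp only
    rw [Function.comp_apply, Equiv.swap_apply_eq_iff, Equiv.swap_apply_right]

/-- Adjacent tiers contain equally many vertices in total. -/
lemma sum_card_tier_succ (V : Finset ℕ) {m j : ℕ} (hj : 1 ≤ j) (hjm : j + 1 ≤ m) :
    ∑ p ∈ tieredTrees V m, (V.filter fun v => p.2 v = j).card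
      = ∑ p ∈ tieredTrees V m, (V.filter fun v => p.2 v = j + 1).card := by
  rw [← twistedTrees_lt j]
  obtain ⟨n, hn⟩ := V.exists_nat_subset_range
  rw [← twistedTierCount, ← twistedTierCount,
    ← twistedTierCount_viaEmbedding (n := n) Fin.revPerm]
  refine twistedTierCount_reverse hj hjm fun x hx y hy => ?_
  have h : ∀ x ∈ V, Fin.revPerm.viaEmbedding (Fin.valEmbedding (n := n + 1)) x = n - x := by
    intro x hx
    have hx' := Finset.mem_range.mp (hn hx)
    have h := Equiv.Perm.viaEmbedding_apply Fin.revPerm (Fin.valEmbedding (n := n + 1))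
      ⟨x, by omega⟩
    simp only [Fin.valEmbedding_apply] at h
    rw [h]
    simp [Fin.val_rev]
  have hx' := Finset.mem_range.mp (hn hx)
  have hy' := Finset.mem_range.mp (hn hy)
  rw [h x hx, h y hy]
  omega

/-! ### Counting -/

lemma card_rootedTieredTrees (V : Finset ℕ) (m : ℕ) (Y : Finset ℕ) :
    (rootedTieredTrees V m Y).card =
      ∑ j ∈ Y, ∑ p ∈ tieredTrees V m, (V.filter fun v => p.2 v = j).card := by
  rw [Finset.sum_comm, Finset.card_eq_sum_card_fiberwise (f := Prod.fst) (t := tieredTrees V m)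
    fun q hq => (mem_rootedTieredTrees.mp hq).1]
  refine Finset.sum_congr rfl fun p hp => ?_
  have h : ((rootedTieredTrees V m Y).filter fun q => q.1 = p).card
      = (V.filter fun v => p.2 v ∈ Y).card := by
    refine Finset.card_bij' (fun q _ => q.2) (fun v _ => (p, v)) ?_ ?_ ?_ ?_
    · rintro ⟨q, v⟩ hq
      obtain ⟨hqm, rfl⟩ := Finset.mem_filter.mp hq
      exact Finset.mem_filter.mpr (mem_rootedTieredTrees.mp hqm).2
    · intro v hv
      exact Finset.mem_filter.mpr
        ⟨mem_rootedTieredTrees.mpr ⟨hp, Finset.mem_filter.mp hv⟩, rfl⟩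
    · rintro ⟨q, v⟩ hq
      obtain ⟨-, rfl⟩ := Finset.mem_filter.mp hq
      rfl
    · exact fun _ _ => rfl
  have hmaps : ((V.filter fun v => p.2 v ∈ Y : Finset ℕ) : Set ℕ).MapsTo p.2 Y :=
    fun v hv => (Finset.mem_filter.mp hv).2
  rw [h, Finset.card_eq_sum_card_fiberwise hmaps]
  refine Finset.sum_congr rfl fun j hj => ?_
  rw [Finset.filter_filter]
  congr 1
  refine Finset.filter_congr fun v _ => ⟨fun h => h.2, fun h => ⟨h ▸ hj, h⟩⟩

/-- The number of vertices of a given tier, summed over all tiered trees, is independent of the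
tier. -/
lemma sum_card_tier_eq (V : Finset ℕ) {m j : ℕ} (hj : j ∈ Finset.Icc 1 m) :
    ∑ p ∈ tieredTrees V m, (V.filter fun v => p.2 v = j).card
      = ∑ p ∈ tieredTrees V m, (V.filter fun v => p.2 v = 1).card := by
  obtain ⟨h1, h2⟩ := Finset.mem_Icc.mp hj
  induction j, h1 using Nat.le_induction with
  | base => rfl
  | succ j hj1 ih =>
    rw [← sum_card_tier_succ V hj1 h2]
    exact ih (Finset.mem_Icc.mpr ⟨hj1, by omega⟩) (by omega)

lemma mul_card_rootedTieredTrees (V : Finset ℕ) (m : ℕ) {Y : Finset ℕ}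
    (hY : Y ⊆ Finset.Icc 1 m) :
    m * (rootedTieredTrees V m Y).card = Y.card * (V.card * (tieredTrees V m).card) := by
  have h : ∀ Y ⊆ Finset.Icc 1 m, (rootedTieredTrees V m Y).card =
      Y.card * ∑ p ∈ tieredTrees V m, (V.filter fun v => p.2 v = 1).card := by
    intro Y hY
    rw [card_rootedTieredTrees, Finset.sum_congr rfl fun j hj => sum_card_tier_eq V (hY hj),
      Finset.sum_const, smul_eq_mul]
  have htot : (rootedTieredTrees V m (Finset.Icc 1 m)).card
      = V.card * (tieredTrees V m).card := by
    rw [rootedTieredTrees, Finset.filter_true_of_mem, Finset.card_product, mul_comm]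
    intro q hq
    obtain ⟨hq1, hq2⟩ := Finset.mem_product.mp hq
    exact (mem_tieredTrees.mp hq1).1 _ hq2
  rw [h Y hY, ← htot, h _ subset_rfl, Nat.card_Icc, Nat.add_sub_cancel]
  ring

lemma card_ghostTrees_of_card_tieredTrees {m k : ℕ} (hm : m ≠ 0)
    (hT : ∀ V : Finset ℕ, V.Nonempty → V.card ≤ k →
      (V.card * (tieredTrees V m).card : ℚ) = m * abelCoeff m V.card)
    {g : ℕ} {V Y : Finset ℕ} (hg : g ∉ V) (hV : V.card ≤ k) (hY : Y ⊆ Finset.Icc 1 m) :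
    ((ghostTrees g V m Y).card : ℚ) = (abelPoly m V.card).eval (Y.card : ℚ) := by
  have hm' : (m : ℚ) ≠ 0 := Nat.cast_ne_zero.mpr hm
  have hR : ∀ S : Finset ℕ, S.Nonempty → S.card ≤ k →
      ((rootedTieredTrees S m Y).card : ℚ) = Y.card * abelCoeff m S.card := by
    intro S hS hSk
    have h := congrArg (Nat.cast (R := ℚ)) (mul_card_rootedTieredTrees S m hY)
    push_cast at h
    rw [hT S hS hSk] at h
    refine mul_left_cancel₀ hm' ?_
    rw [h]
    ring
  induction hn : V.card using Nat.strong_induction_on generalizing V with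
  | _ n ih =>
    rcases V.eq_empty_or_nonempty with rfl | ⟨v, hv⟩
    · subst hn
      simp [card_ghostTrees_empty, abelPoly]
    · obtain ⟨n, rfl⟩ : ∃ n', n = n' + 1 :=
        ⟨n - 1, by have := Finset.card_pos.mpr ⟨v, hv⟩; omega⟩
      have hW : (V.erase v).card = n := by rw [Finset.card_erase_of_mem hv, hn]; rfl
      rw [card_ghostTrees_eq_sum m Y hg hv, eval_abelPoly_succ]
      have hfil : V.powerset.filter (v ∈ ·) = (V.erase v).powerset.image (insert v) := by
        ext S
        simp only [Finset.mem_filter, Finset.mem_powerset, Finset.mem_image]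
        constructor
        · exact fun h => ⟨S.erase v, Finset.erase_subset_erase v h.1, Finset.insert_erase h.2⟩
        · rintro ⟨U, hU, rfl⟩
          exact ⟨Finset.insert_subset hv (hU.trans (Finset.erase_subset _ _)),
            Finset.mem_insert_self _ _⟩
      have hinj : Set.InjOn (insert v) ((V.erase v).powerset : Set (Finset ℕ)) := by
        intro A hA B hB h
        have hA' : v ∉ A := fun h => Finset.notMem_erase v V (Finset.mem_powerset.mp hA h)
        have hB' : v ∉ B := fun h => Finset.notMem_erase v V (Finset.mem_powerset.mp hB h)
        rw [← Finset.erase_insert hA', ← Finset.erase_insert hB', h]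
      rw [hfil, Finset.sum_image hinj, Nat.cast_sum]
      have hterm : ∀ U ∈ (V.erase v).powerset,
          (((rootedTieredTrees (insert v U) m Y).card *
            (ghostTrees g (V \ insert v U) m Y).card : ℕ) : ℚ)
          = (Y.card * abelCoeff m (U.card + 1)) *
            (abelPoly m (n - U.card)).eval (Y.card : ℚ) := by
        intro U hU
        have hU := Finset.mem_powerset.mp hU
        have hvU : v ∉ U := fun h => Finset.notMem_erase v V (hU h)
        have hsub : insert v U ⊆ V :=
          Finset.insert_subset hv (hU.trans (Finset.erase_subset _ _))
        have hc : (insert v U).card = U.card + 1 := Finset.card_insert_of_notMem hvU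
        have hd : (V \ insert v U).card = n - U.card := by
          rw [Finset.card_sdiff_of_subset hsub, hc, hn]
          omega
        have hle := Finset.card_le_card hsub
        rw [Nat.cast_mul, hR _ (Finset.insert_nonempty v U) (hle.trans hV), hc,
          ih (n - U.card) (by omega) (fun h => hg (Finset.mem_sdiff.mp h).1)
            (by omega) hd]
      rw [Finset.sum_congr rfl hterm, Finset.sum_powerset_apply_card (fun i =>
        (Y.card * abelCoeff m (i + 1)) * (abelPoly m (n - i)).eval (Y.card : ℚ)), hW]
      exact Finset.sum_congr rfl fun i _ => nsmul_eq_mul _ _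

lemma card_mul_card_tieredTrees {m : ℕ} (hm : m ≠ 0) {V : Finset ℕ} (hV : V.Nonempty) :
    (V.card * (tieredTrees V m).card : ℚ) = m * abelCoeff m V.card := by
  induction hn : V.card using Nat.strong_induction_on generalizing V with
  | _ n ih =>
    obtain ⟨n, rfl⟩ : ∃ n', n = n' + 1 :=
      ⟨n - 1, by have := Finset.card_pos.mpr hV; omega⟩
    set g := V.min' hV
    have hgV : g ∈ V := V.min'_mem hV
    have hlt : ∀ v ∈ V.erase g, g < v := fun v hv => V.min'_lt_of_mem_erase_min' hV hv
    have hc : (V.erase g).card = n := by rw [Finset.card_erase_of_mem hgV, hn]; rfl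
    have hT : ∀ S : Finset ℕ, S.Nonempty → S.card ≤ n →
        (S.card * (tieredTrees S m).card : ℚ) = m * abelCoeff m S.card :=
      fun S hS hSn => ih S.card (by omega) hS rfl
    have hG : ∀ j ∈ Finset.Icc 1 m, ((ghostTrees g (V.erase g) m (Finset.Ioc j m)).card : ℚ)
        = (abelPoly m n).eval ((m - j : ℕ) : ℚ) := by
      intro j hj
      rw [card_ghostTrees_of_card_tieredTrees hm hT (Finset.notMem_erase g V) hc.le, hc,
        Nat.card_Ioc]
      intro i hi
      have := Finset.mem_Ioc.mp hi
      exact Finset.mem_Icc.mpr (by omega)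
    have hsum : ((tieredTrees V m).card : ℚ)
        = ∑ c ∈ Finset.range m, (abelPoly m n).eval (c : ℚ) := by
      rw [← Finset.insert_erase hgV, card_tieredTrees_insert g _ m hlt, Nat.cast_sum,
        Finset.sum_congr rfl hG]
      refine Finset.sum_bij' (fun j _ => m - j) (fun c _ => m - c) ?_ ?_ ?_ ?_ ?_ <;>
        intro j hj <;> simp only [Finset.mem_Icc, Finset.mem_range] at hj ⊢ <;> omega
    rw [hsum, ← sum_eval_abelPoly m n hm]
    push_cast
    rfl

/-- For `m ≥ 2` and `n ≥ 2`, the number `T_{n,m}` of tiered trees on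
`{1,…,n}` with tiers valued in `{1,…,m}` satisfies
`T_{n,m} · n · m^{n−1} = Σ (n choose k₁,…,k_m) ((m−1)k₁ + (m−2)k₂ + ⋯ + k_{m−1})^{n−1}`,
the sum over tuples of nonnegative integers with `k₁ + ⋯ + k_m = n` (here `k_j = f ⟨j-1⟩`). -/
theorem tiered_tree_count_formula (n m : ℕ) (hn : 2 ≤ n) (hm : 2 ≤ m) :
    Tcount n m * (n * m ^ (n - 1))
      = ∑ f ∈ Finset.Nat.antidiagonalTuple m n,
          Nat.multinomial Finset.univ f *
            (∑ j : Fin m, (m - 1 - (j : ℕ)) * f j) ^ (n - 1) := by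
  have hm0 : m ≠ 0 := by omega
  have hV : (Finset.Icc 1 n).Nonempty := Finset.nonempty_Icc.mpr (by omega)
  have h := card_mul_card_tieredTrees hm0 hV
  rw [Nat.card_Icc, Nat.add_sub_cancel, ← Tcount_eq_card_tieredTrees] at h
  have hmain : (Tcount n m * (n * m ^ (n - 1)) : ℚ) = (m : ℚ) ^ n * abelCoeff m n := by
    have hpow : (m : ℚ) ^ n = m ^ (n - 1) * m := by
      rw [← pow_succ, Nat.sub_add_cancel (by omega)]
    rw [hpow, mul_assoc, ← h]
    ring
  rw [abelCoeff_eq_sum_multinomial m n hm0] at hmain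
  exact_mod_cast hmain
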